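/- arXiv:1410.0849 — 3 statements merged into one kernel-verified Lean document; each statement's English description precedes it below -/
import Mathlib

section
/- In the braid group B_4, with c = σ_3 σ_2, b_X = σ_2⁻² σ_1⁻¹ σ_2⁻¹ σ_1⁻⁵ σ_3 σ_1⁻¹ σ_3 σ_2 σ_1 and b_Y = σ_3⁻⁴ σ_1 σ_3⁻¹ σ_1 σ_3⁻³, one has b_X = c · b_Y · c⁻¹; in particular the braids b_X and b_Y obtained from the two projection angles are conjugate in B_4. -/
/-- The braid relations on `m` generators `σ_1, …, σ_m` (0-indexed as `Fin m`):
far-apart generators commute, adjacent ones satisfy the braid relation. -/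
def braidRels (m : ℕ) : Set (FreeGroup (Fin m)) :=
  {r | ∃ i j : Fin m, ((i : ℕ) + 2 ≤ (j : ℕ) ∨ (j : ℕ) + 2 ≤ (i : ℕ)) ∧
        r = FreeGroup.of i * FreeGroup.of j * (FreeGroup.of i)⁻¹ * (FreeGroup.of j)⁻¹} ∪
  {r | ∃ i j : Fin m, (i : ℕ) + 1 = (j : ℕ) ∧
        r = FreeGroup.of i * FreeGroup.of j * FreeGroup.of i *
            (FreeGroup.of j * FreeGroup.of i * FreeGroup.of j)⁻¹}

/-- The Artin braid group on `n` strings, with the `n - 1` generators `σ n 0, …, σ n (n-2)`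
(0-indexed; `σ n i` is the generator `σ_{i+1}` in 1-based notation). -/
abbrev BraidGroup (n : ℕ) := PresentedGroup (braidRels (n - 1))

/-- The Artin generator of the braid group (0-indexed). -/
def σ (n : ℕ) (i : Fin (n - 1)) : BraidGroup n := PresentedGroup.of i


theorem braid_aux {G : Type*} [Group G] (a b c : G) (h1 : a * b * a = b * a * b)
    (h2 : b * c * b = c * b * c) (h3 : a * c = c * a) :
    b⁻¹ ^ 2 * a⁻¹ * b⁻¹ * a⁻¹ ^ 5 * c * a⁻¹ * c * b * a =
      (c * b) * (c⁻¹ ^ 4 * a * c⁻¹ * a * c⁻¹ ^ 3) * (c * b)⁻¹ := by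
  have hac : Commute a c := h3
  have e1 : b⁻¹ ^ 2 * a⁻¹ * b⁻¹ = (b * a)⁻¹ * a⁻¹ ^ 2 := by
    have k : b * a * b ^ 2 = a ^ 2 * (b * a) := by
      calc b * a * b ^ 2 = (b * a * b) * b := by simp only [pow_succ, pow_zero, one_mul, mul_one, mul_assoc, mul_inv_rev, inv_inv, inv_mul_cancel_left, mul_inv_cancel_left]
        _ = a * (b * a * b) := by rw [← h1]; simp only [mul_assoc] at h1 ⊢; rw [h1]
        _ = a ^ 2 * (b * a) := by rw [← h1]; simp only [pow_succ, pow_zero, one_mul, mul_one, mul_assoc, mul_inv_rev, inv_inv, inv_mul_cancel_left, mul_inv_cancel_left]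
    have k' := congrArg (fun x => x⁻¹) k
    simp only [mul_inv_rev] at k'
    calc b⁻¹ ^ 2 * a⁻¹ * b⁻¹ = (b ^ 2)⁻¹ * (a⁻¹ * b⁻¹) := by simp only [pow_succ, pow_zero, one_mul, mul_one, mul_assoc, mul_inv_rev, inv_inv, inv_mul_cancel_left, mul_inv_cancel_left]
      _ = _ := by rw [k']; simp only [pow_succ, pow_zero, one_mul, mul_one, mul_assoc, mul_inv_rev, inv_inv, inv_mul_cancel_left, mul_inv_cancel_left]
  have e2 : c * a⁻¹ * c = a⁻¹ * c ^ 2 := by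
    rw [← (hac.inv_left).eq]; simp only [pow_succ, pow_zero, one_mul, mul_one, mul_assoc, mul_inv_rev, inv_inv, inv_mul_cancel_left, mul_inv_cancel_left]
  have e3 : c⁻¹ ^ 4 * a * c⁻¹ * a * c⁻¹ ^ 3 = c⁻¹ ^ 8 * a ^ 2 := by
    have q : Commute a c⁻¹ := hac.inv_right
    have q3 : a ^ 2 * c⁻¹ ^ 3 = c⁻¹ ^ 3 * a ^ 2 := (q.pow_pow 2 3).eq
    calc c⁻¹ ^ 4 * a * c⁻¹ * a * c⁻¹ ^ 3 = c⁻¹ ^ 4 * (a * c⁻¹) * a * c⁻¹ ^ 3 := by simp only [pow_succ, pow_zero, one_mul, mul_one, mul_assoc, mul_inv_rev, inv_inv, inv_mul_cancel_left, mul_inv_cancel_left]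
      _ = c⁻¹ ^ 5 * (a ^ 2 * c⁻¹ ^ 3) := by rw [q.eq]; simp only [pow_succ, pow_zero, one_mul, mul_one, mul_assoc, mul_inv_rev, inv_inv, inv_mul_cancel_left, mul_inv_cancel_left]
      _ = _ := by rw [q3]; simp only [pow_succ, pow_zero, one_mul, mul_one, mul_assoc, mul_inv_rev, inv_inv, inv_mul_cancel_left, mul_inv_cancel_left]
  have f1 : (b * a)⁻¹ * a * (b * a) = b := by
    rw [mul_assoc, inv_mul_eq_iff_eq_mul, ← mul_assoc, h1]
  have f2 : (c * b) * c * (c * b)⁻¹ = b := by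
    rw [mul_inv_eq_iff_eq_mul, ← h2, mul_assoc]
  have f3 : (b * a)⁻¹ * c * (b * a) = (c * b) * a * (c * b)⁻¹ := by
    rw [eq_mul_inv_iff_mul_eq, mul_assoc, mul_assoc, inv_mul_eq_iff_eq_mul]
    calc c * (b * a * (c * b)) = c * b * (a * c) * b := by simp only [pow_succ, pow_zero, one_mul, mul_one, mul_assoc, mul_inv_rev, inv_inv, inv_mul_cancel_left, mul_inv_cancel_left]
      _ = (c * b * c) * (a * b) := by rw [h3]; simp only [pow_succ, pow_zero, one_mul, mul_one, mul_assoc, mul_inv_rev, inv_inv, inv_mul_cancel_left, mul_inv_cancel_left]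
      _ = b * c * (b * a * b) := by rw [← h2]; simp only [pow_succ, pow_zero, one_mul, mul_one, mul_assoc, mul_inv_rev, inv_inv, inv_mul_cancel_left, mul_inv_cancel_left]
      _ = b * (c * a) * b * a := by rw [← h1]; simp only [pow_succ, pow_zero, one_mul, mul_one, mul_assoc, mul_inv_rev, inv_inv, inv_mul_cancel_left, mul_inv_cancel_left]
      _ = b * a * (c * b * a) := by rw [← h3]; simp only [pow_succ, pow_zero, one_mul, mul_one, mul_assoc, mul_inv_rev, inv_inv, inv_mul_cancel_left, mul_inv_cancel_left]
  rw [e3]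
  calc b⁻¹ ^ 2 * a⁻¹ * b⁻¹ * a⁻¹ ^ 5 * c * a⁻¹ * c * b * a
      = (b⁻¹ ^ 2 * a⁻¹ * b⁻¹) * a⁻¹ ^ 5 * (c * a⁻¹ * c) * (b * a) := by simp only [pow_succ, pow_zero, one_mul, mul_one, mul_assoc, mul_inv_rev, inv_inv, inv_mul_cancel_left, mul_inv_cancel_left]
    _ = ((b * a)⁻¹ * a * (b * a))⁻¹ ^ 8 * ((b * a)⁻¹ * c * (b * a)) ^ 2 := by
        rw [e1, e2]; simp only [pow_succ, pow_zero, one_mul, mul_one, mul_assoc, mul_inv_rev, inv_inv, inv_mul_cancel_left, mul_inv_cancel_left]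
    _ = ((c * b) * c * (c * b)⁻¹)⁻¹ ^ 8 * ((c * b) * a * (c * b)⁻¹) ^ 2 := by rw [f1, f2, f3]
    _ = _ := by simp only [pow_succ, pow_zero, one_mul, mul_one, mul_assoc, mul_inv_rev, inv_inv, inv_mul_cancel_left, mul_inv_cancel_left]

theorem braid_adj (i j : Fin (4 - 1)) (h : (i : ℕ) + 1 = j) :
    σ 4 i * σ 4 j * σ 4 i = σ 4 j * σ 4 i * σ 4 j := by
  have := PresentedGroup.one_of_mem (rels := braidRels (4 - 1)) (Or.inr ⟨i, j, h, rfl⟩)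
  rw [map_mul, map_inv, mul_inv_eq_one] at this
  simp only [map_mul] at this
  exact this

theorem braid_far (i j : Fin (4 - 1)) (h : (i : ℕ) + 2 ≤ j) :
    σ 4 i * σ 4 j = σ 4 j * σ 4 i := by
  have := PresentedGroup.one_of_mem (rels := braidRels (4 - 1)) (Or.inl ⟨i, j, Or.inl h, rfl⟩)
  rw [map_mul, map_inv, mul_inv_eq_one, map_mul, map_inv, mul_inv_eq_iff_eq_mul] at this
  simp only [map_mul] at this
  exact this

/-- In `B_4`, with `c = σ_3 σ_2`,
`b_X = σ_2⁻² σ_1⁻¹ σ_2⁻¹ σ_1⁻⁵ σ_3 σ_1⁻¹ σ_3 σ_2 σ_1` and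
`b_Y = σ_3⁻⁴ σ_1 σ_3⁻¹ σ_1 σ_3⁻³`, one has `b_X = c * b_Y * c⁻¹`;
in particular `b_X` and `b_Y` are conjugate in `B_4`. -/
theorem projection_braids_conjugate :
    ((σ 4 1)⁻¹ ^ 2 * (σ 4 0)⁻¹ * (σ 4 1)⁻¹ * (σ 4 0)⁻¹ ^ 5 * σ 4 2 * (σ 4 0)⁻¹ * σ 4 2 *
        σ 4 1 * σ 4 0 =
      (σ 4 2 * σ 4 1) * ((σ 4 2)⁻¹ ^ 4 * σ 4 0 * (σ 4 2)⁻¹ * σ 4 0 * (σ 4 2)⁻¹ ^ 3) *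
        (σ 4 2 * σ 4 1)⁻¹) ∧
    IsConj ((σ 4 2)⁻¹ ^ 4 * σ 4 0 * (σ 4 2)⁻¹ * σ 4 0 * (σ 4 2)⁻¹ ^ 3)
      ((σ 4 1)⁻¹ ^ 2 * (σ 4 0)⁻¹ * (σ 4 1)⁻¹ * (σ 4 0)⁻¹ ^ 5 * σ 4 2 * (σ 4 0)⁻¹ * σ 4 2 *
        σ 4 1 * σ 4 0) := by
  have key := braid_aux (σ 4 0) (σ 4 1) (σ 4 2) (braid_adj 0 1 rfl) (braid_adj 1 2 rfl)
    (braid_far 0 2 le_rfl)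
  exact ⟨key, isConj_iff.2 ⟨_, key.symm⟩⟩
end

section
/- For every n ≥ 4 and every i with 1 < i < n−1, the Dynnikov update map F_i : ℤ^{2n−4} → ℤ^{2n−4} associated with the braid generator σ_i is a bijection. -/
/-- The positive part `x⁺ = max(x, 0)`. -/
def pPart (x : ℤ) : ℤ := max x 0

/-- The negative part `x⁻ = min(x, 0)`. -/
def nPart (x : ℤ) : ℤ := min x 0

/-- The Dynnikov update map `F_i : ℤ^{2n−4} → ℤ^{2n−4}` associated with the braid
generator `σ_i` (1-based index `i`, intended for `1 < i < n−1`), acting on loop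
(Dynnikov) coordinates `(a_1, …, a_{n−2}, b_1, …, b_{n−2})` for `n` punctures:
`a_p` is stored at index `p − 1` and `b_p` at index `(n−2) + (p−1)`.
With `c = a_{i−1} − a_i − b_i⁺ + b_{i−1}⁻`, it sends `(a, b)` to `(a′, b′)` where
`a′_{i−1} = a_{i−1} − b_{i−1}⁺ − (b_i⁺ + c)⁺`, `b′_{i−1} = b_i + c⁻`,
`a′_i = a_i − b_i⁻ − (b_{i−1}⁻ − c)⁻`, `b′_i = b_{i−1} − c⁻`,
and all other coordinates are unchanged. -/
def dynnikovF (n i : ℕ) (v : Fin (2 * n - 4) → ℤ) : Fin (2 * n - 4) → ℤ :=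
  -- `a p` is the coordinate `a_{p+1}` (0-indexed `p`), stored at index `p`
  let a : ℕ → ℤ := fun p => if h : p < 2 * n - 4 then v ⟨p, h⟩ else 0
  -- `b p` is the coordinate `b_{p+1}` (0-indexed `p`), stored at index `(n−2) + p`
  let b : ℕ → ℤ := fun p => if h : n - 2 + p < 2 * n - 4 then v ⟨n - 2 + p, h⟩ else 0
  let c : ℤ := a (i - 2) - a (i - 1) - pPart (b (i - 1)) + nPart (b (i - 2))
  fun k =>
    if (k : ℕ) = i - 2 then
      a (i - 2) - pPart (b (i - 2)) - pPart (pPart (b (i - 1)) + c)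
    else if (k : ℕ) = i - 1 then
      a (i - 1) - nPart (b (i - 1)) - nPart (nPart (b (i - 2)) - c)
    else if (k : ℕ) = n - 2 + (i - 2) then b (i - 1) + nPart c
    else if (k : ℕ) = n - 2 + (i - 1) then b (i - 2) - nPart c
    else v k

theorem part_add (x : ℤ) : pPart x + nPart x = x := by
  simp only [pPart, nPart]; omega

theorem pp_add (x c : ℤ) : pPart (pPart x + c) = pPart (x + nPart c) + pPart c := by
  simp only [pPart, nPart]; omega

theorem nn_sub (x c : ℤ) : nPart (nPart x - c) = nPart (x - nPart c) - pPart c := by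
  simp only [pPart, nPart]; omega

theorem pp_add' (x c : ℤ) : pPart (pPart (x - nPart c) + c) = pPart x + pPart c := by
  simp only [pPart, nPart]; omega

theorem nn_sub' (x c : ℤ) : nPart (nPart (x + nPart c) - c) = nPart x - pPart c := by
  simp only [pPart, nPart]; omega

/-- The four-coordinate core of the update, composed with the reflection `a ↦ -a`,
is an involution. -/
theorem core_invol (a A b B : ℤ) (c a' A' b' B' d : ℤ)
    (hc : c = a - A - pPart B + nPart b)
    (ha : a' = -(a - pPart b - pPart (pPart B + c)))
    (hA : A' = -(A - nPart B - nPart (nPart b - c)))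
    (hb : b' = B + nPart c) (hB : B' = b - nPart c)
    (hd : d = a' - A' - pPart B' + nPart b') :
    -(a' - pPart b' - pPart (pPart B' + d)) = a ∧
    -(A' - nPart B' - nPart (nPart b' - d)) = A ∧
    B' + nPart d = b ∧ b' - nPart d = B := by
  have i1 := pp_add B c
  have i2 := nn_sub b c
  have i3 := pp_add' b c
  have i4 := nn_sub' B c
  have i5 := part_add B
  have i6 := part_add b
  have i7 := part_add c
  have i8 := part_add (B + nPart c)
  have i9 := part_add (b - nPart c)
  subst hb hB
  have hdc : d = c := by linarith
  subst hdc
  refine ⟨?_, ?_, ?_, ?_⟩ <;> linarith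

/-- The reflection negating the coordinates `a_{i-1}, a_i`. -/
def reflA (n i : ℕ) (v : Fin (2 * n - 4) → ℤ) : Fin (2 * n - 4) → ℤ :=
  fun k => if (k : ℕ) = i - 2 ∨ (k : ℕ) = i - 1 then -v k else v k

theorem reflA_invol (n i : ℕ) : Function.Involutive (reflA n i) := by
  intro v
  funext k
  simp only [reflA]
  split_ifs <;> simp

theorem reflF_invol (n i : ℕ) (hn : 4 ≤ n) (hi1 : 1 < i) (hi2 : i < n - 1) :
    Function.Involutive (fun v => reflA n i (dynnikovF n i v)) := by
  intro v
  have h1 : i - 2 < 2 * n - 4 := by omega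
  have h2 : i - 1 < 2 * n - 4 := by omega
  have h3 : n - 2 + (i - 2) < 2 * n - 4 := by omega
  have h4 : n - 2 + (i - 1) < 2 * n - 4 := by omega
  have e1 : i - 1 ≠ i - 2 := by omega
  have e2 : n - 2 + (i - 2) ≠ i - 2 := by omega
  have e3 : n - 2 + (i - 2) ≠ i - 1 := by omega
  have e4 : n - 2 + (i - 1) ≠ i - 2 := by omega
  have e5 : n - 2 + (i - 1) ≠ i - 1 := by omega
  have e6 : n - 2 + (i - 1) ≠ n - 2 + (i - 2) := by omega
  obtain ⟨q1, q2, q3, q4⟩ := core_invol (v ⟨_, h1⟩) (v ⟨_, h2⟩) (v ⟨_, h3⟩) (v ⟨_, h4⟩)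
    _ _ _ _ _ _ rfl rfl rfl rfl rfl rfl
  have key : ∀ w : Fin (2 * n - 4) → ℤ, ∀ k, reflA n i (dynnikovF n i w) k =
      if (k : ℕ) = i - 2 then
        -(w ⟨_, h1⟩ - pPart (w ⟨_, h3⟩) - pPart (pPart (w ⟨_, h4⟩) +
          (w ⟨_, h1⟩ - w ⟨_, h2⟩ - pPart (w ⟨_, h4⟩) + nPart (w ⟨_, h3⟩))))
      else if (k : ℕ) = i - 1 then
        -(w ⟨_, h2⟩ - nPart (w ⟨_, h4⟩) - nPart (nPart (w ⟨_, h3⟩) -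
          (w ⟨_, h1⟩ - w ⟨_, h2⟩ - pPart (w ⟨_, h4⟩) + nPart (w ⟨_, h3⟩))))
      else if (k : ℕ) = n - 2 + (i - 2) then w ⟨_, h4⟩ +
          nPart (w ⟨_, h1⟩ - w ⟨_, h2⟩ - pPart (w ⟨_, h4⟩) + nPart (w ⟨_, h3⟩))
      else if (k : ℕ) = n - 2 + (i - 1) then w ⟨_, h3⟩ -
          nPart (w ⟨_, h1⟩ - w ⟨_, h2⟩ - pPart (w ⟨_, h4⟩) + nPart (w ⟨_, h3⟩))
      else w k := by
    intro w k
    simp only [reflA, dynnikovF, dif_pos h1, dif_pos h2, dif_pos h3, dif_pos h4]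
    by_cases c1 : (k : ℕ) = i - 2
    · simp only [c1, true_or, if_true]
    by_cases c2 : (k : ℕ) = i - 1
    · simp only [c2, e1, or_true, if_true, if_false]
    simp only [c1, c2, or_false, if_false]
  funext k
  change reflA n i (dynnikovF n i (reflA n i (dynnikovF n i v))) k = v k
  rw [key]
  simp only [key v, if_true, if_neg e1, if_neg e2, if_neg e3, if_neg e4, if_neg e5, if_neg e6]
  rw [q1, q2, q3, q4]
  split_ifs with c1 c2 c3 c4
  · exact congrArg v (Fin.ext c1.symm)
  · exact congrArg v (Fin.ext c2.symm)
  · exact congrArg v (Fin.ext c3.symm)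
  · exact congrArg v (Fin.ext c4.symm)
  · rfl

/-- For every `n ≥ 4` and every `i` with `1 < i < n−1`, the Dynnikov update map
`F_i : ℤ^{2n−4} → ℤ^{2n−4}` associated with `σ_i` is a bijection. -/
theorem dynnikovF_bijective (n i : ℕ) (hn : 4 ≤ n) (hi1 : 1 < i) (hi2 : i < n - 1) :
    Function.Bijective (dynnikovF n i) := by
  have h := (reflA_invol n i).bijective.comp (reflF_invol n i hn hi1 hi2).bijective
  have e : reflA n i ∘ (fun v => reflA n i (dynnikovF n i v)) = dynnikovF n i := by
    funext v
    exact reflA_invol n i (dynnikovF n i v)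
  rwa [e] at h
end

section
/- For every n ≥ 4, every i with 1 < i < n−1, and every v ∈ ℤ^{2n−4}, there exists an integer matrix M of size (2n−4)×(2n−4) with det M = 1 such that F_i(v) = M·v, where F_i is the Dynnikov update map associated with σ_i; that is, the piecewise-linear Dynnikov action admits an effective linear action in SL_{2n−4}(ℤ) at every point. -/
/-- The local matrix on the cone `c ≤ 0`, with 0/1 parameters recording the signs. -/
def locMat (p q g d : ℤ) : Matrix (Fin 4) (Fin 4) ℤ :=
  !![1 - g, g, -(1 - q) - g * q, 0;
     d, 1 - d, 0, -(1 - p) - d * p;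
     1, -1, q, 1 - p;
     -1, 1, 1 - q, p]

lemma local_exists (x y z w : ℤ) :
    ∃ A : Matrix (Fin 4) (Fin 4) ℤ, A.det = 1 ∧
      A.mulVec ![x, y, z, w] =
        ![x - pPart z - pPart (pPart w + (x - y - pPart w + nPart z)),
          y - nPart w - nPart (nPart z - (x - y - pPart w + nPart z)),
          w + nPart (x - y - pPart w + nPart z),
          z - nPart (x - y - pPart w + nPart z)] := by
  by_cases hc : 0 ≤ x - y - pPart w + nPart z
  · refine ⟨!![0, 1, -1, 0; 1, 0, 0, -1; 0, 0, 0, 1; 0, 0, 1, 0], by decide, ?_⟩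
    ext j
    fin_cases j <;> simp [Matrix.mulVec, dotProduct, Fin.sum_univ_four] <;>
      simp only [pPart, nPart] at * <;> omega
  · have key : ∀ p q g d : ℤ, (locMat p q g d).mulVec ![x, y, z, w] =
        ![(1 - g) * x + g * y + (-(1 - q) - g * q) * z,
          d * x + (1 - d) * y + (-(1 - p) - d * p) * w,
          x - y + q * z + (1 - p) * w,
          -x + y + (1 - q) * z + p * w] := by
      intro p q g d
      ext j
      fin_cases j <;> simp [locMat, Matrix.mulVec, dotProduct, Fin.sum_univ_four] <;> ring
    refine ⟨locMat (if 0 < w then 1 else 0) (if z < 0 then 1 else 0)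
      (if 0 < x - y + nPart z then 1 else 0) (if y - x + pPart w < 0 then 1 else 0), ?_, ?_⟩
    · split_ifs <;> first
        | decide
        | (exfalso; simp only [pPart, nPart] at *; omega)
    · rw [key]
      clear key
      split_ifs <;> ext j <;> fin_cases j <;> simp <;> simp only [pPart, nPart] at * <;> omega

lemma extend_exists {N : ℕ} (e : Fin 4 → Fin N) (he : Function.Injective e)
    (A : Matrix (Fin 4) (Fin 4) ℤ) (hA : A.det = 1) (v : Fin N → ℤ) :
    ∃ M : Matrix (Fin N) (Fin N) ℤ, M.det = 1 ∧
      (∀ j, M.mulVec v (e j) = A.mulVec (v ∘ e) j) ∧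
      (∀ k, (∀ j, k ≠ e j) → M.mulVec v k = v k) := by
  let P : Matrix (Fin N) (Fin 4) ℤ := Matrix.of fun k j => if k = e j then 1 else 0
  have hP : P.transpose * P = 1 := by
    ext j l
    simp [P, Matrix.mul_apply, Matrix.one_apply, he.eq_iff, eq_comm]
  have hPv : P.transpose.mulVec v = v ∘ e := by
    ext j
    simp [P, Matrix.mulVec, dotProduct]
  have hM : (1 + P * ((A - 1) * P.transpose)).mulVec v
      = v + P.mulVec (A.mulVec (v ∘ e) - v ∘ e) := by
    rw [Matrix.add_mulVec, Matrix.one_mulVec, ← Matrix.mulVec_mulVec, ← Matrix.mulVec_mulVec,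
      hPv, Matrix.sub_mulVec, Matrix.one_mulVec]
  refine ⟨1 + P * ((A - 1) * P.transpose), ?_, ?_, ?_⟩
  · rw [Matrix.det_one_add_mul_comm, Matrix.mul_assoc, hP, Matrix.mul_one, add_sub_cancel, hA]
  · intro j
    rw [hM]
    have : ∀ u : Fin 4 → ℤ, P.mulVec u (e j) = u j := by
      intro u
      simp [P, Matrix.mulVec, dotProduct, he.eq_iff]
    simp [this]
  · intro k hk
    rw [hM]
    have : ∀ u : Fin 4 → ℤ, P.mulVec u k = 0 := by
      intro u
      simp [P, Matrix.mulVec, dotProduct, hk]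
    simp [this]

/-- For every `n ≥ 4`, every `i` with `1 < i < n−1`, and every `v ∈ ℤ^{2n−4}`, there is an
integer matrix `M` of size `(2n−4) × (2n−4)` with `det M = 1` such that `F_i v = M • v`:
the piecewise-linear Dynnikov action admits an effective linear action in
`SL_{2n−4}(ℤ)` at every point. -/
theorem dynnikovF_effective_linear_action (n i : ℕ) (hn : 4 ≤ n) (hi1 : 1 < i)
    (hi2 : i < n - 1) (v : Fin (2 * n - 4) → ℤ) :
    ∃ M : Matrix (Fin (2 * n - 4)) (Fin (2 * n - 4)) ℤ,
      M.det = 1 ∧ dynnikovF n i v = M.mulVec v := by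
  have h0 : i - 2 < 2 * n - 4 := by omega
  have h1 : i - 1 < 2 * n - 4 := by omega
  have h2 : n - 2 + (i - 2) < 2 * n - 4 := by omega
  have h3 : n - 2 + (i - 1) < 2 * n - 4 := by omega
  let e : Fin 4 → Fin (2 * n - 4) :=
    ![⟨i - 2, h0⟩, ⟨i - 1, h1⟩, ⟨n - 2 + (i - 2), h2⟩, ⟨n - 2 + (i - 1), h3⟩]
  have he : Function.Injective e := by
    intro j l h
    have h' := congrArg Fin.val h
    fin_cases j <;> fin_cases l <;> simp [e] at h' ⊢ <;> omega
  obtain ⟨A, hA, hAv⟩ := local_exists (v (e 0)) (v (e 1)) (v (e 2)) (v (e 3))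
  have hve : v ∘ e = ![v (e 0), v (e 1), v (e 2), v (e 3)] := by
    ext j
    fin_cases j <;> rfl
  obtain ⟨M, hM, hMe, hMk⟩ := extend_exists e he A hA v
  rw [hve, hAv] at hMe
  refine ⟨M, hM, ?_⟩
  have n1 : ¬ (i - 1 = i - 2) := by omega
  have n2 : ¬ (n - 2 + (i - 2) = i - 2) := by omega
  have n3 : ¬ (n - 2 + (i - 2) = i - 1) := by omega
  have n4 : ¬ (n - 2 + (i - 1) = i - 2) := by omega
  have n5 : ¬ (n - 2 + (i - 1) = i - 1) := by omega
  have n6 : ¬ (n - 2 + (i - 1) = n - 2 + (i - 2)) := by omega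
  funext k
  by_cases k0 : k = e 0
  · rw [k0, hMe 0]
    simp only [dynnikovF, dif_pos h0, dif_pos h1, dif_pos h2, dif_pos h3]
    exact if_pos rfl
  by_cases k1 : k = e 1
  · rw [k1, hMe 1]
    simp only [dynnikovF, dif_pos h0, dif_pos h1, dif_pos h2, dif_pos h3]
    exact (if_neg n1).trans (if_pos rfl)
  by_cases k2 : k = e 2
  · rw [k2, hMe 2]
    simp only [dynnikovF, dif_pos h0, dif_pos h1, dif_pos h2, dif_pos h3]
    exact (if_neg n2).trans ((if_neg n3).trans (if_pos rfl))
  by_cases k3 : k = e 3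
  · rw [k3, hMe 3]
    simp only [dynnikovF, dif_pos h0, dif_pos h1, dif_pos h2, dif_pos h3]
    exact (if_neg n4).trans ((if_neg n5).trans ((if_neg n6).trans (if_pos rfl)))
  rw [hMk k (by intro j; fin_cases j <;> assumption)]
  have m0 : ¬ ((k : ℕ) = i - 2) := fun h => k0 (Fin.ext h)
  have m1 : ¬ ((k : ℕ) = i - 1) := fun h => k1 (Fin.ext h)
  have m2 : ¬ ((k : ℕ) = n - 2 + (i - 2)) := fun h => k2 (Fin.ext h)
  have m3 : ¬ ((k : ℕ) = n - 2 + (i - 1)) := fun h => k3 (Fin.ext h)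
  simp only [dynnikovF, if_neg m0, if_neg m1, if_neg m2, if_neg m3]
end
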